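/- Let G be a countable group, Σ a nonempty finite alphabet, and Ω a relative system over G with alphabet Σ satisfying the weak topological Markov property relative to Θ. Let Φ be an absolutely summable relative interaction on Ω with Gibbs kernels (K_A). Suppose μ is a probability measure on Ω and A ⊆ G is a finite set with Ψ_μ(A | A^c) < Ψ_{μK_A}(A | A^c). Then there exist ε > 0 and a finite set B₀ ⊆ G with B₀ ⊇ A such that Ψ_μ(A | B∖A) ≤ Ψ_{μ'K_A}(A | B∖A) − ε for every finite set B ⊆ G with B ⊇ B₀ and every probability measure μ' on Ω whose restriction to the σ-algebra F_Θ ∨ ξ^{B₀} agrees with that of μ. -/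

import Mathlib

open MeasureTheory Filter Topology
open scoped Pointwise ENNReal
noncomputable section

namespace DLR

variable (G : Type) [Group G] [Countable G] [DecidableEq G]
variable (S : Type) [Fintype S] [Nonempty S] [TopologicalSpace S] [DiscreteTopology S]
  [MeasurableSpace S] [MeasurableSingletonClass S]
variable (Θ : Type) [MeasurableSpace Θ]

/-- The translation action of `G` on configurations: `(g • x)_k = x_{g⁻¹ k}`. -/
def shift (g : G) (x : G → S) : G → S := fun k => x (g⁻¹ * k)

/-- A relative system over `G` with alphabet `S` and environment space `Θ`. -/
structure RelSystem where
  act : G → Θ → Θ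
  act_one : ∀ θ, act 1 θ = θ
  act_mul : ∀ g h θ, act (g * h) θ = act g (act h θ)
  act_measurable : ∀ g, Measurable (act g)
  X : Θ → Set (G → S)
  X_closed : ∀ θ, IsClosed (X θ)
  omega_measurable : MeasurableSet {p : Θ × (G → S) | p.2 ∈ X p.1}
  X_equivariant : ∀ g θ, X (act g θ) = (shift G S g) '' (X θ)

variable {G S Θ}

/-- The total space of a relative system, as a subset of `Θ × Σ^G`. -/
def RelSystem.Omega (R : RelSystem G S Θ) : Set (Θ × (G → S)) := {p | p.2 ∈ R.X p.1}

/-- The σ-algebra on `Θ × Σ^G` generated by the environment coordinate. -/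
def FTheta : MeasurableSpace (Θ × (G → S)) := MeasurableSpace.comap Prod.fst inferInstance

/-- The σ-algebra on `Θ × Σ^G` generated by the configuration restricted to `B ⊆ G`. -/
def xi (B : Set G) : MeasurableSpace (Θ × (G → S)) :=
  MeasurableSpace.comap (fun p => (fun b : B => p.2 b)) inferInstance

/-- The cylinder set of a pattern `u` with support a finite set `A ⊆ G`. -/
def cyl (A : Finset G) (u : A → S) : Set (Θ × (G → S)) := {p | ∀ a : A, p.2 a = u a}

/-- Merging a pattern `u` on `A` with a configuration `x` off `A`: `x_{G∖A} ∨ u`. -/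
def mergePat (A : Finset G) (x : G → S) (u : A → S) : G → S :=
  fun k => if h : k ∈ A then u ⟨k, h⟩ else x k

/-- A bounded relatively continuous observable (membership in `C_Θ(Ω)`). -/
def RelCont (R : RelSystem G S Θ) (f : Θ × (G → S) → ℝ) : Prop :=
  Measurable f ∧ (∃ c : ℝ, ∀ p ∈ R.Omega, |f p| ≤ c) ∧
    ∀ ε > 0, ∃ A : Finset G, ∀ θ : Θ, ∀ x ∈ R.X θ, ∀ y ∈ R.X θ,
      (∀ a ∈ A, x a = y a) → |f (θ, x) - f (θ, y)| < ε

variable (G S Θ) in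
/-- A relative interaction on a relative system. -/
structure Interaction (R : RelSystem G S Θ) where
  Phi : Finset G → Θ × (G → S) → ℝ
  measurable' : ∀ A : Finset G, Measurable[FTheta ⊔ xi (↑A : Set G)] (Phi A)
  bounded' : ∀ A : Finset G, ∃ c : ℝ, ∀ p, |Phi A p| ≤ c
  equivariant' : ∀ (g : G) (A : Finset G) (p : Θ × (G → S)),
    Phi (A.image (g * ·)) p = Phi A (R.act g⁻¹ p.1, shift G S g⁻¹ p.2)

variable {R : RelSystem G S Θ}

/-- The supremum norm of the `A`-component of an interaction. -/
def supAbs {α : Type} (f : α → ℝ) : ℝ := ⨆ p, |f p|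

/-- Absolute summability of a relative interaction. -/
def Interaction.AbsSummable (Φ : Interaction G S Θ R) : Prop :=
  Summable (fun A : Finset G => if (1 : G) ∈ A then supAbs (Φ.Phi A) else 0)

/-- The norm `‖Φ‖` of an absolutely summable interaction. -/
def Interaction.norm (Φ : Interaction G S Θ R) : ℝ :=
  ∑' A : Finset G, if (1 : G) ∈ A then supAbs (Φ.Phi A) else 0

/-- The energy `E_A = Σ_{C ⊆ A} Φ_C` of a finite region `A`. -/
def energy (Φ : Interaction G S Θ R) (A : Finset G) (p : Θ × (G → S)) : ℝ :=
  ∑ C ∈ A.powerset, Φ.Phi C p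

/-- The conditional energy `E_{A|A^c} = Σ_{C ∩ A ≠ ∅} Φ_C`. -/
def condEnergy (Φ : Interaction G S Θ R) (A : Finset G) (p : Θ × (G → S)) : ℝ :=
  ∑' C : Finset G, if (C ∩ A).Nonempty then Φ.Phi C p else 0

/-- The conditional energy `E_{A|B} = E_{A∪B} - E_B` for finite `A`, `B`. -/
def condEnergyFin (Φ : Interaction G S Θ R) (A B : Finset G) (p : Θ × (G → S)) : ℝ :=
  energy Φ (A ∪ B) p - energy Φ B p

open Classical in
/-- The partition function `Z_{A|A^c}(θ,x)`. -/
def partitionZ (Φ : Interaction G S Θ R) (A : Finset G) (p : Θ × (G → S)) : ℝ :=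
  ∑ u : A → S, if mergePat A p.2 u ∈ R.X p.1
    then Real.exp (-(condEnergy Φ A (p.1, mergePat A p.2 u))) else 0

open Classical in
/-- The Gibbs kernel `K_A((θ,x),·)` associated to an interaction. -/
def gibbsKernel (Φ : Interaction G S Θ R) (A : Finset G) (p : Θ × (G → S)) :
    Measure (Θ × (G → S)) :=
  ∑ u : A → S, if mergePat A p.2 u ∈ R.X p.1
    then (ENNReal.ofReal (Real.exp (-(condEnergy Φ A (p.1, mergePat A p.2 u))) /
            partitionZ Φ A p)) • Measure.dirac (p.1, mergePat A p.2 u)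
    else 0

/-- Conditional entropy `H_μ(ξ^A | m)` of the partition into `A`-cylinders given
a sub-σ-algebra `m`, defined via conditional expectation. -/
def condEntropy (μ : Measure (Θ × (G → S))) (A : Finset G)
    (m : MeasurableSpace (Θ × (G → S))) : ℝ :=
  ∫ p, (∑ u : A → S,
    Real.negMulLog ((μ[Set.indicator (cyl A u) (fun _ => (1:ℝ)) | m]) p)) ∂μ

/-- The conditional relative pressure `Ψ_μ(A | A^c)`. -/
def pressureCond (Φ : Interaction G S Θ R) (μ : Measure (Θ × (G → S))) (A : Finset G) : ℝ :=
  condEntropy μ A (xi ((↑A : Set G)ᶜ) ⊔ FTheta) - ∫ p, condEnergy Φ A p ∂μ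

/-- The conditional relative pressure `Ψ_μ(A | B)` for finite disjoint `A`, `B`. -/
def pressureCondFin (Φ : Interaction G S Θ R) (μ : Measure (Θ × (G → S)))
    (A B : Finset G) : ℝ :=
  condEntropy μ A (xi (↑B : Set G) ⊔ FTheta) - ∫ p, condEnergyFin Φ A B p ∂μ

/-- Weak topological Markov property relative to `Θ`. -/
def RelSystem.WeakTMP (R : RelSystem G S Θ) : Prop :=
  ∀ A : Finset G, ∃ B : Finset G, A ⊆ B ∧ ∀ θ : Θ, ∀ x ∈ R.X θ, ∀ x' ∈ R.X θ,
    (∀ g ∈ B \ A, x g = x' g) → (fun g => if g ∈ B then x g else x' g) ∈ R.X θ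

/-- A right Følner sequence in a countable group. -/
def RightFolner (F : ℕ → Finset G) : Prop :=
  (∀ n, (F n).Nonempty) ∧
  ∀ g : G, Tendsto (fun n => ((symmDiff (F n) ((F n).image (· * g))).card : ℝ) / (F n).card)
    atTop (𝓝 0)


set_option linter.unusedSectionVars false

lemma FTheta_le : (FTheta : MeasurableSpace (Θ × (G → S))) ≤ Prod.instMeasurableSpace :=
  measurable_fst.comap_le

lemma xi_le (B : Set G) : (xi B : MeasurableSpace (Θ × (G → S))) ≤ Prod.instMeasurableSpace :=
  (measurable_pi_lambda _ fun b : B => (measurable_pi_apply b.1).comp measurable_snd).comap_le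

lemma xi_sup_FTheta_le (B : Set G) :
    (xi B ⊔ FTheta : MeasurableSpace (Θ × (G → S))) ≤ Prod.instMeasurableSpace :=
  sup_le (xi_le B) FTheta_le

lemma measurable_xi_eval {B : Set G} {k : G} (hk : k ∈ B) :
    Measurable[xi B] (fun p : Θ × (G → S) => p.2 k) :=
  (measurable_pi_apply (⟨k, hk⟩ : B)).comp
    (comap_measurable (fun p : Θ × (G → S) => (fun b : B => p.2 b)))

lemma xi_mono {B B' : Set G} (h : B ⊆ B') :
    (xi B : MeasurableSpace (Θ × (G → S))) ≤ xi B' := by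
  refine Measurable.comap_le ?_
  exact @measurable_pi_lambda _ _ _ (xi B') _ _ fun b => measurable_xi_eval (h b.2)

lemma FTheta_sup_xi_eq_comap (B : Set G) :
    (FTheta ⊔ xi B : MeasurableSpace (Θ × (G → S))) =
      MeasurableSpace.comap (fun p => (p.1, fun b : B => p.2 b)) inferInstance := by
  simp only [FTheta, xi]
  exact (MeasurableSpace.comap_prodMk _ _).symm

lemma measurable_merge_exterior (A : Finset G) (u : A → S) :
    Measurable[xi ((↑A : Set G)ᶜ) ⊔ FTheta]
      (fun p : Θ × (G → S) => (p.1, mergePat A p.2 u)) := by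
  let m : MeasurableSpace (Θ × (G → S)) := xi ((↑A : Set G)ᶜ) ⊔ FTheta
  refine @Measurable.prodMk _ m _ _ _ _ (fun p => p.1) (fun p => mergePat A p.2 u) ?_ ?_
  · exact (comap_measurable (Prod.fst : Θ × (G → S) → Θ)).mono le_sup_right le_rfl
  · refine @measurable_pi_lambda _ _ _ m _ _ fun k => ?_
    by_cases hk : k ∈ A
    · simp only [mergePat, hk, dite_true]
      exact measurable_const
    · simp only [mergePat, hk, dite_false]
      exact (measurable_xi_eval (by simpa using hk)).mono le_sup_left le_rfl

lemma measurable_merge (A : Finset G) (u : A → S) :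
    Measurable (fun p : Θ × (G → S) => (p.1, mergePat A p.2 u)) :=
  (measurable_merge_exterior A u).mono (xi_sup_FTheta_le _) le_rfl


lemma Interaction.measurable_Phi (Φ : Interaction G S Θ R) (C : Finset G) :
    Measurable (Φ.Phi C) :=
  (Φ.measurable' C).mono (sup_le FTheta_le (xi_le _)) le_rfl

lemma Interaction.Phi_congr (Φ : Interaction G S Θ R) (C : Finset G) {θ : Θ} {x y : G → S}
    (h : ∀ g ∈ C, x g = y g) : Φ.Phi C (θ, x) = Φ.Phi C (θ, y) := by
  have hm := Φ.measurable' C (measurableSet_singleton (Φ.Phi C (θ, x)))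
  rw [FTheta_sup_xi_eq_comap] at hm
  obtain ⟨V, -, hV⟩ := hm
  have hx : (θ, x) ∈ Φ.Phi C ⁻¹' {Φ.Phi C (θ, x)} := rfl
  have hxy : (fun b : (↑C : Set G) => x b) = fun b : (↑C : Set G) => y b :=
    funext fun b => h b b.2
  rw [← hV, Set.mem_preimage, hxy] at hx
  have hy : (θ, y) ∈ Φ.Phi C ⁻¹' {Φ.Phi C (θ, x)} := by
    rw [← hV]
    exact hx
  exact hy.symm

lemma Interaction.abs_Phi_le_supAbs (Φ : Interaction G S Θ R) (C : Finset G)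
    (p : Θ × (G → S)) : |Φ.Phi C p| ≤ supAbs (Φ.Phi C) := by
  obtain ⟨c, hc⟩ := Φ.bounded' C
  exact le_ciSup (f := fun q => |Φ.Phi C q|) ⟨c, by rintro _ ⟨q, rfl⟩; exact hc q⟩ p

lemma supAbs_nonneg {α : Type} (f : α → ℝ) : 0 ≤ supAbs f :=
  Real.iSup_nonneg fun _ => abs_nonneg _

lemma Interaction.supAbs_Phi_image_le (Φ : Interaction G S Θ R) (g : G) (C : Finset G) :
    supAbs (Φ.Phi (C.image (g * ·))) ≤ supAbs (Φ.Phi C) := by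
  refine Real.iSup_le (fun p => ?_) (supAbs_nonneg _)
  rw [Φ.equivariant']
  exact Φ.abs_Phi_le_supAbs _ _

lemma Interaction.summable_supAbs_mem {Φ : Interaction G S Θ R} (hΦ : Φ.AbsSummable) (a : G) :
    Summable (fun C : Finset G => if a ∈ C then supAbs (Φ.Phi C) else 0) := by
  have h := (Equiv.mulLeft a⁻¹).finsetCongr.summable_iff.2 hΦ
  refine Summable.of_nonneg_of_le (fun C => ?_) (fun C => ?_) h
  · split_ifs
    exacts [supAbs_nonneg _, le_rfl]
  · have hC : (Equiv.mulLeft a⁻¹).finsetCongr C = C.image (a⁻¹ * ·) := by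
      ext k
      simp [Equiv.finsetCongr_apply]
    simp only [Function.comp_apply, hC]
    by_cases ha : a ∈ C
    · have h1 : (1 : G) ∈ C.image (a⁻¹ * ·) := Finset.mem_image.2 ⟨a, ha, by simp⟩
      rw [if_pos ha, if_pos h1]
      have h2 := Φ.supAbs_Phi_image_le a (C.image (a⁻¹ * ·))
      have h3 : (C.image (a⁻¹ * ·)).image (a * ·) = C := by
        rw [Finset.image_image]
        simp only [Function.comp_def, mul_inv_cancel_left, Finset.image_id']
      rwa [h3] at h2
    · rw [if_neg ha]
      split_ifs
      exacts [supAbs_nonneg _, le_rfl]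

/-- The bound on the `C`-term of the conditional energy of `A`. -/
def energyBound (Φ : Interaction G S Θ R) (A C : Finset G) : ℝ :=
  if (C ∩ A).Nonempty then supAbs (Φ.Phi C) else 0

lemma summable_energyBound {Φ : Interaction G S Θ R} (hΦ : Φ.AbsSummable) (A : Finset G) :
    Summable (energyBound Φ A) := by
  have h := summable_sum (s := A) fun a _ => Interaction.summable_supAbs_mem hΦ a
  refine Summable.of_nonneg_of_le (fun C => ?_) (fun C => ?_) h
  · unfold energyBound
    split_ifs
    exacts [supAbs_nonneg _, le_rfl]
  · have hnn : ∀ a ∈ A, 0 ≤ if a ∈ C then supAbs (Φ.Phi C) else 0 := fun a _ => by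
      split_ifs
      exacts [supAbs_nonneg _, le_rfl]
    unfold energyBound
    split_ifs with hC
    · obtain ⟨a, ha⟩ := hC
      rw [Finset.mem_inter] at ha
      calc supAbs (Φ.Phi C) = if a ∈ C then supAbs (Φ.Phi C) else 0 := by rw [if_pos ha.1]
        _ ≤ _ := Finset.single_le_sum hnn ha.2
    · exact Finset.sum_nonneg hnn

lemma abs_energyTerm_le (Φ : Interaction G S Θ R) (A C : Finset G) (p : Θ × (G → S)) :
    |if (C ∩ A).Nonempty then Φ.Phi C p else 0| ≤ energyBound Φ A C := by
  unfold energyBound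
  split_ifs
  · exact Φ.abs_Phi_le_supAbs C p
  · simp

lemma summable_energyTerm {Φ : Interaction G S Θ R} (hΦ : Φ.AbsSummable) (A : Finset G)
    (p : Θ × (G → S)) :
    Summable (fun C : Finset G => if (C ∩ A).Nonempty then Φ.Phi C p else 0) :=
  Summable.of_norm_bounded (summable_energyBound hΦ A) fun C => abs_energyTerm_le Φ A C p

lemma measurable_condEnergy {Φ : Interaction G S Θ R} (hΦ : Φ.AbsSummable) (A : Finset G) :
    Measurable (condEnergy Φ A) := by
  refine measurable_of_tendsto_metrizable' (atTop : Filter (Finset (Finset G)))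
    (f := fun s p => ∑ C ∈ s, if (C ∩ A).Nonempty then Φ.Phi C p else 0) (fun s => ?_) ?_
  · refine Finset.measurable_sum _ fun C _ => ?_
    split_ifs
    exacts [Φ.measurable_Phi C, measurable_const]
  · exact tendsto_pi_nhds.2 fun p => (summable_energyTerm hΦ A p).hasSum

lemma abs_condEnergy_le {Φ : Interaction G S Θ R} (hΦ : Φ.AbsSummable) (A : Finset G)
    (p : Θ × (G → S)) : |condEnergy Φ A p| ≤ ∑' C, energyBound Φ A C := by
  rw [← Real.norm_eq_abs]
  exact tsum_of_norm_bounded (summable_energyBound hΦ A).hasSum fun C => abs_energyTerm_le Φ A C p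

lemma measurable_condEnergyFin (Φ : Interaction G S Θ R) (A B : Finset G) :
    Measurable (condEnergyFin Φ A B) :=
  (Finset.measurable_sum _ fun C _ => Φ.measurable_Phi C).sub
    (Finset.measurable_sum _ fun C _ => Φ.measurable_Phi C)

lemma condEnergyFin_sdiff (Φ : Interaction G S Θ R) {A B : Finset G} (hAB : A ⊆ B)
    (p : Θ × (G → S)) :
    condEnergyFin Φ A (B \ A) p =
      ∑ C ∈ B.powerset, if (C ∩ A).Nonempty then Φ.Phi C p else 0 := by
  have h : (B \ A).powerset = B.powerset.filter (fun C => ¬ (C ∩ A).Nonempty) := by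
    ext C
    simp only [Finset.mem_powerset, Finset.mem_filter, Finset.not_nonempty_iff_eq_empty,
      ← Finset.disjoint_iff_inter_eq_empty, Finset.subset_sdiff]
  rw [condEnergyFin, energy, energy, Finset.union_sdiff_of_subset hAB, h, ← Finset.sum_filter,
    sub_eq_iff_eq_add, Finset.sum_filter_add_sum_filter_not]

lemma exists_condEnergy_approx {Φ : Interaction G S Θ R} (hΦ : Φ.AbsSummable) (A : Finset G)
    {δ : ℝ} (hδ : 0 < δ) :
    ∃ B₁ : Finset G, A ⊆ B₁ ∧ ∀ B : Finset G, B₁ ⊆ B → ∀ p : Θ × (G → S),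
      |condEnergy Φ A p - condEnergyFin Φ A (B \ A) p| ≤ δ := by
  have hs := summable_energyBound hΦ A
  obtain ⟨T, hT⟩ := eventually_atTop.1 (hs.hasSum.eventually (lt_mem_nhds (sub_lt_self _ hδ)))
  refine ⟨A ∪ T.sup id, Finset.subset_union_left, fun B hB p => ?_⟩
  have hTB : T ⊆ B.powerset := fun C hC => Finset.mem_powerset.2
    ((Finset.le_sup (f := id) hC).trans (Finset.subset_union_right.trans hB))
  have h1 := hT _ hTB
  rw [condEnergyFin_sdiff Φ (Finset.subset_union_left.trans hB), condEnergy,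
    ← (summable_energyTerm hΦ A p).sum_add_tsum_subtype_compl B.powerset, add_sub_cancel_left]
  have h2 := hs.sum_add_tsum_subtype_compl B.powerset
  have h3 : |∑' C : {C // C ∉ B.powerset},
      (if (C.1 ∩ A).Nonempty then Φ.Phi C.1 p else 0)| ≤
        ∑' C : {C // C ∉ B.powerset}, energyBound Φ A C.1 := by
    rw [← Real.norm_eq_abs]
    exact tsum_of_norm_bounded (hs.subtype {C | C ∉ B.powerset}).hasSum fun C => abs_energyTerm_le Φ A C.1 p
  linarith

lemma condEnergyFin_congr (Φ : Interaction G S Θ R) (A : Finset G) {B : Finset G} {θ : Θ}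
    {x y : G → S} (hAB : A ⊆ B) (h : ∀ g ∈ B, x g = y g) :
    condEnergyFin Φ A (B \ A) (θ, x) = condEnergyFin Φ A (B \ A) (θ, y) := by
  rw [condEnergyFin_sdiff Φ hAB, condEnergyFin_sdiff Φ hAB]
  refine Finset.sum_congr rfl fun C hC => ?_
  rw [Φ.Phi_congr C fun g hg => h g (Finset.mem_powerset.1 hC hg)]

lemma measurableSet_cyl (A : Finset G) (u : A → S) :
    MeasurableSet (cyl A u : Set (Θ × (G → S))) := by
  have h : (cyl A u : Set (Θ × (G → S))) = ⋂ a : A, (fun p => p.2 a) ⁻¹' {u a} := by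
    ext p
    simp [cyl]
  rw [h]
  exact MeasurableSet.iInter fun a =>
    ((measurable_pi_apply a.1).comp measurable_snd) (measurableSet_singleton _)

lemma integrable_indicator_cyl (μ : Measure (Θ × (G → S))) [IsFiniteMeasure μ] (A : Finset G)
    (u : A → S) : Integrable (Set.indicator (cyl A u) (fun _ => (1 : ℝ))) μ :=
  (integrable_const 1).indicator (measurableSet_cyl A u)

lemma condExp_cyl_mem_Icc (μ : Measure (Θ × (G → S))) [IsFiniteMeasure μ] (A : Finset G)
    (u : A → S) {m : MeasurableSpace (Θ × (G → S))} (hm : m ≤ Prod.instMeasurableSpace) :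
    ∀ᵐ p ∂μ, (μ[Set.indicator (cyl A u) (fun _ => (1 : ℝ)) | m]) p ∈ Set.Icc (0 : ℝ) 1 := by
  refine Convex.condExp_mem hm (integrable_indicator_cyl μ A u) isClosed_Icc (convex_Icc 0 1)
    (Eventually.of_forall fun p => ?_)
  by_cases hp : p ∈ cyl A u <;> simp [hp]

lemma negMulLog_le_one {x : ℝ} (hx : 0 ≤ x) : Real.negMulLog x ≤ 1 := by
  rcases hx.eq_or_lt with rfl | hx
  · simp
  · have h := Real.log_le_sub_one_of_pos (inv_pos.2 hx)
    rw [Real.log_inv] at h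
    have h2 := mul_le_mul_of_nonneg_left h hx.le
    rw [mul_sub, mul_inv_cancel₀ hx.ne'] at h2
    rw [Real.negMulLog]
    linarith

lemma norm_negMulLog_le_one {x : ℝ} (hx : x ∈ Set.Icc (0 : ℝ) 1) : ‖Real.negMulLog x‖ ≤ 1 := by
  rw [Real.norm_of_nonneg (Real.negMulLog_nonneg hx.1 hx.2)]
  exact negMulLog_le_one hx.1

lemma integrable_negMulLog_condExp_cyl (μ : Measure (Θ × (G → S))) [IsFiniteMeasure μ]
    (A : Finset G) (u : A → S) {m : MeasurableSpace (Θ × (G → S))}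
    (hm : m ≤ Prod.instMeasurableSpace) :
    Integrable (fun p =>
      Real.negMulLog ((μ[Set.indicator (cyl A u) (fun _ => (1 : ℝ)) | m]) p)) μ :=
  Integrable.of_bound (Real.continuous_negMulLog.comp_aestronglyMeasurable
      (stronglyMeasurable_condExp.mono hm).aestronglyMeasurable) 1
    ((condExp_cyl_mem_Icc μ A u hm).mono fun _ hp => norm_negMulLog_le_one hp)

lemma condEntropy_eq_sum (μ : Measure (Θ × (G → S))) [IsFiniteMeasure μ]
    (A : Finset G) {m : MeasurableSpace (Θ × (G → S))} (hm : m ≤ Prod.instMeasurableSpace) :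
    condEntropy μ A m = ∑ u : A → S, ∫ p,
      Real.negMulLog ((μ[Set.indicator (cyl A u) (fun _ => (1 : ℝ)) | m]) p) ∂μ :=
  integral_finsetSum _ fun u _ => integrable_negMulLog_condExp_cyl μ A u hm

/-- Conditioning on a finer σ-algebra decreases the entropy. -/
lemma condEntropy_anti (μ : Measure (Θ × (G → S))) [IsFiniteMeasure μ] (A : Finset G)
    {m₁ m₂ : MeasurableSpace (Θ × (G → S))} (h12 : m₁ ≤ m₂)
    (hm₂ : m₂ ≤ Prod.instMeasurableSpace) :
    condEntropy μ A m₂ ≤ condEntropy μ A m₁ := by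
  have hm₁ := h12.trans hm₂
  rw [condEntropy_eq_sum μ A hm₁, condEntropy_eq_sum μ A hm₂]
  refine Finset.sum_le_sum fun u _ => ?_
  set f := Set.indicator (cyl A u : Set (Θ × (G → S))) (fun _ => (1 : ℝ))
  have hint := integrable_negMulLog_condExp_cyl μ A u hm₂
  have hJ := Real.concaveOn_negMulLog.condExp_map_le hm₁
    (Real.continuous_negMulLog.upperSemicontinuous.upperSemicontinuousOn _)
    ((condExp_cyl_mem_Icc μ A u hm₂).mono fun _ hp => hp.1) isClosed_Ici
    integrable_condExp hint
  rw [← integral_condExp hm₁]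
  refine integral_mono_ae integrable_condExp (integrable_negMulLog_condExp_cyl μ A u hm₁) ?_
  filter_upwards [hJ, condExp_condExp_of_le (f := f) (μ := μ) h12 hm₂] with p hp hp'
  rw [Function.comp_apply, hp'] at hp
  exact hp

lemma iSup_xi_sup_FTheta {F : ℕ → Set G} :
    ⨆ n, (xi (F n) ⊔ FTheta : MeasurableSpace (Θ × (G → S))) = xi (⋃ n, F n) ⊔ FTheta := by
  rw [iSup_sup_eq, iSup_const]
  congr 1
  refine le_antisymm (iSup_le fun n => xi_mono (Set.subset_iUnion F n)) ?_
  refine Measurable.comap_le ?_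
  refine @measurable_pi_lambda _ _ _ (⨆ n, xi (F n)) _ _ fun b => ?_
  obtain ⟨n, hn⟩ := Set.mem_iUnion.1 b.2
  exact (measurable_xi_eval hn).mono (le_iSup (fun n => xi (F n)) n) le_rfl

/-- The entropy given finitely many outer coordinates approximates the entropy given all of
them. -/
lemma exists_condEntropy_le (μ : Measure (Θ × (G → S))) [IsFiniteMeasure μ] (A : Finset G)
    {δ : ℝ} (hδ : 0 < δ) :
    ∃ B₂ : Finset G, ∀ B : Finset G, B₂ ⊆ B →
      condEntropy μ A (xi (↑(B \ A) : Set G) ⊔ FTheta) ≤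
        condEntropy μ A (xi ((↑A : Set G)ᶜ) ⊔ FTheta) + δ := by
  obtain ⟨F, hF⟩ := exists_seq_tendsto (atTop : Filter (Finset G))
  obtain ⟨F, hFmono, hFcov⟩ : ∃ F : ℕ → Finset G, Monotone F ∧ ∀ g, ∃ n, g ∈ F n := by
    refine ⟨fun n => (Finset.range (n + 1)).sup F, fun a b hab => Finset.sup_mono
      (Finset.range_mono (by omega)), fun g => ?_⟩
    obtain ⟨n, hn⟩ := (hF.eventually (eventually_ge_atTop {g})).exists
    exact ⟨n, Finset.mem_sup.2 ⟨n, by simp, Finset.singleton_subset_iff.1 hn⟩⟩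
  let ℱ : Filtration ℕ (Prod.instMeasurableSpace : MeasurableSpace (Θ × (G → S))) :=
    { seq := fun n => xi (↑(F n \ A) : Set G) ⊔ FTheta
      mono' := fun a b hab => sup_le_sup_right (xi_mono (by
        exact_mod_cast Finset.sdiff_subset_sdiff (hFmono hab) le_rfl)) _
      le' := fun n => xi_sup_FTheta_le _ }
  have hsup : ⨆ n, ℱ n = xi ((↑A : Set G)ᶜ) ⊔ FTheta := by
    have hU : ⋃ n, (↑(F n \ A) : Set G) = (↑A : Set G)ᶜ := by
      ext g
      simp only [Finset.coe_sdiff, Set.mem_iUnion, Set.mem_sdiff, Finset.mem_coe, Set.mem_compl_iff]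
      exact ⟨fun ⟨_, h⟩ => h.2, fun h => (hFcov g).imp fun _ hn => ⟨hn, h⟩⟩
    rw [← hU]
    exact iSup_xi_sup_FTheta
  have hlim : Tendsto (fun n => condEntropy μ A (ℱ n)) atTop
      (𝓝 (condEntropy μ A (xi ((↑A : Set G)ᶜ) ⊔ FTheta))) := by
    rw [← hsup]
    have hle : ⨆ n, ℱ n ≤ Prod.instMeasurableSpace := iSup_le ℱ.le
    rw [condEntropy_eq_sum μ A hle]
    simp_rw [fun n => condEntropy_eq_sum μ A (ℱ.le n)]
    refine tendsto_finsetSum _ fun u _ => ?_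
    refine tendsto_integral_of_dominated_convergence (fun _ => 1)
      (fun n => (integrable_negMulLog_condExp_cyl μ A u (ℱ.le n)).aestronglyMeasurable)
      (integrable_const _)
      (fun n => (condExp_cyl_mem_Icc μ A u (ℱ.le n)).mono fun _ hp => norm_negMulLog_le_one hp) ?_
    filter_upwards [tendsto_ae_condExp (μ := μ) (ℱ := ℱ)
      (Set.indicator (cyl A u) (fun _ => (1 : ℝ)))] with p hp
    exact (Real.continuous_negMulLog.tendsto _).comp hp
  obtain ⟨n, hn⟩ := (hlim.eventually (gt_mem_nhds (lt_add_of_pos_right _ hδ))).exists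
  refine ⟨F n, fun B hB => le_trans (condEntropy_anti μ A (sup_le_sup_right (xi_mono ?_) _)
    (xi_sup_FTheta_le _)) hn.le⟩
  exact_mod_cast Finset.sdiff_subset_sdiff hB le_rfl

lemma mergePat_mergePat (A : Finset G) (x : G → S) (u v : A → S) :
    mergePat A (mergePat A x v) u = mergePat A x u := by
  funext k
  by_cases hk : k ∈ A <;> simp [mergePat, hk]

lemma mergePat_self (A : Finset G) (x : G → S) : mergePat A x (fun a => x a) = x := by
  funext k
  by_cases hk : k ∈ A <;> simp [mergePat, hk]

lemma merge_mem_cyl_iff (A : Finset G) (p : Θ × (G → S)) (u v : A → S) :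
    (p.1, mergePat A p.2 v) ∈ cyl A u ↔ v = u := by
  simp only [cyl, Set.mem_ofPred_eq]
  refine ⟨fun h => funext fun a => ?_, fun h a => ?_⟩
  · simpa [mergePat] using h a
  · simp [mergePat, h]

lemma merge_mem_iff {A : Finset G} {W : Set (Θ × (G → S))}
    (hW : MeasurableSet[xi ((↑A : Set G)ᶜ) ⊔ FTheta] W) (p : Θ × (G → S)) (v : A → S) :
    (p.1, mergePat A p.2 v) ∈ W ↔ p ∈ W := by
  rw [sup_comm, FTheta_sup_xi_eq_comap] at hW
  obtain ⟨V, -, rfl⟩ := hW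
  have h : (fun b : ((↑A : Set G)ᶜ : Set G) => mergePat A p.2 v b) =
      fun b : ((↑A : Set G)ᶜ : Set G) => p.2 b := by
    funext b
    have hb : b.1 ∉ A := fun h => b.2 (Finset.mem_coe.2 h)
    simp [mergePat, hb]
  simp only [Set.mem_preimage, h]

open Classical in
/-- The unnormalized Gibbs weight of a point, vanishing off the system. -/
def boltzmann (Φ : Interaction G S Θ R) (A : Finset G) (p : Θ × (G → S)) : ℝ :=
  if p.2 ∈ R.X p.1 then Real.exp (-(condEnergy Φ A p)) else 0

/-- The probability that the Gibbs kernel of `A` gives to the pattern `u`. -/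
def gibbsWeight (Φ : Interaction G S Θ R) (A : Finset G) (u : A → S) (p : Θ × (G → S)) : ℝ :=
  boltzmann Φ A (p.1, mergePat A p.2 u) / partitionZ Φ A p

lemma boltzmann_nonneg (Φ : Interaction G S Θ R) (A : Finset G) (p : Θ × (G → S)) :
    0 ≤ boltzmann Φ A p := by
  unfold boltzmann
  split_ifs
  exacts [(Real.exp_pos _).le, le_rfl]

lemma measurable_boltzmann {Φ : Interaction G S Θ R} (hΦ : Φ.AbsSummable) (A : Finset G) :
    Measurable (boltzmann Φ A) :=
  Measurable.ite R.omega_measurable (measurable_condEnergy hΦ A).neg.exp measurable_const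

lemma partitionZ_eq_sum (Φ : Interaction G S Θ R) (A : Finset G) (p : Θ × (G → S)) :
    partitionZ Φ A p = ∑ u : A → S, boltzmann Φ A (p.1, mergePat A p.2 u) := rfl

lemma partitionZ_pos (Φ : Interaction G S Θ R) (A : Finset G) {p : Θ × (G → S)}
    (hp : p ∈ R.Omega) : 0 < partitionZ Φ A p := by
  rw [partitionZ_eq_sum]
  refine Finset.sum_pos' (fun u _ => boltzmann_nonneg _ _ _)
    ⟨fun a => p.2 a, Finset.mem_univ _, ?_⟩
  have hp' : p.2 ∈ R.X p.1 := hp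
  rw [mergePat_self, boltzmann, if_pos hp']
  exact Real.exp_pos _

lemma partitionZ_nonneg (Φ : Interaction G S Θ R) (A : Finset G) (p : Θ × (G → S)) :
    0 ≤ partitionZ Φ A p := by
  rw [partitionZ_eq_sum]
  exact Finset.sum_nonneg fun u _ => boltzmann_nonneg _ _ _

lemma gibbsWeight_nonneg (Φ : Interaction G S Θ R) (A : Finset G) (u : A → S)
    (p : Θ × (G → S)) : 0 ≤ gibbsWeight Φ A u p :=
  div_nonneg (boltzmann_nonneg _ _ _) (partitionZ_nonneg _ _ _)

lemma gibbsWeight_le_one (Φ : Interaction G S Θ R) (A : Finset G) (u : A → S)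
    (p : Θ × (G → S)) : gibbsWeight Φ A u p ≤ 1 :=
  div_le_one_of_le₀ (Finset.single_le_sum
    (f := fun v : A → S => boltzmann Φ A (p.1, mergePat A p.2 v))
    (fun _ _ => boltzmann_nonneg _ _ _) (Finset.mem_univ u)) (partitionZ_nonneg _ _ _)

lemma sum_gibbsWeight (Φ : Interaction G S Θ R) (A : Finset G) {p : Θ × (G → S)}
    (hp : p ∈ R.Omega) : ∑ u : A → S, gibbsWeight Φ A u p = 1 := by
  simp only [gibbsWeight, ← Finset.sum_div]
  exact div_self (partitionZ_pos Φ A hp).ne'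

lemma gibbsWeight_merge (Φ : Interaction G S Θ R) (A : Finset G) (u v : A → S)
    (p : Θ × (G → S)) :
    gibbsWeight Φ A u (p.1, mergePat A p.2 v) = gibbsWeight Φ A u p := by
  simp only [gibbsWeight, partitionZ_eq_sum, mergePat_mergePat]

lemma measurable_partitionZ_exterior {Φ : Interaction G S Θ R} (hΦ : Φ.AbsSummable)
    (A : Finset G) : Measurable[xi ((↑A : Set G)ᶜ) ⊔ FTheta] (partitionZ Φ A) :=
  Finset.measurable_sum _ fun u _ =>
    (measurable_boltzmann hΦ A).comp (measurable_merge_exterior A u)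

lemma measurable_partitionZ {Φ : Interaction G S Θ R} (hΦ : Φ.AbsSummable)
    (A : Finset G) : Measurable (partitionZ Φ A) :=
  (measurable_partitionZ_exterior hΦ A).mono (xi_sup_FTheta_le _) le_rfl

lemma measurable_gibbsWeight_exterior {Φ : Interaction G S Θ R} (hΦ : Φ.AbsSummable)
    (A : Finset G) (u : A → S) :
    Measurable[xi ((↑A : Set G)ᶜ) ⊔ FTheta] (gibbsWeight Φ A u) :=
  Measurable.div ((measurable_boltzmann hΦ A).comp (measurable_merge_exterior A u))
    (measurable_partitionZ_exterior hΦ A)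

lemma measurable_gibbsWeight {Φ : Interaction G S Θ R} (hΦ : Φ.AbsSummable)
    (A : Finset G) (u : A → S) : Measurable (gibbsWeight Φ A u) :=
  (measurable_gibbsWeight_exterior hΦ A u).mono (xi_sup_FTheta_le _) le_rfl

lemma gibbsKernel_eq_sum (Φ : Interaction G S Θ R) (A : Finset G) (p : Θ × (G → S)) :
    gibbsKernel Φ A p = ∑ u : A → S,
      ENNReal.ofReal (gibbsWeight Φ A u p) • Measure.dirac (p.1, mergePat A p.2 u) := by
  refine Finset.sum_congr rfl fun u _ => ?_
  unfold gibbsWeight boltzmann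
  split_ifs <;> simp

lemma gibbsKernel_apply (Φ : Interaction G S Θ R) (A : Finset G) (p : Θ × (G → S))
    {W : Set (Θ × (G → S))} (hW : MeasurableSet W) :
    gibbsKernel Φ A p W = ∑ u : A → S, ENNReal.ofReal (gibbsWeight Φ A u p) *
      Set.indicator W 1 (p.1, mergePat A p.2 u) := by
  rw [gibbsKernel_eq_sum, Measure.finsetSum_apply]
  refine Finset.sum_congr rfl fun u _ => ?_
  rw [Measure.smul_apply, smul_eq_mul, Measure.dirac_apply' _ hW]

lemma measurable_gibbsKernel {Φ : Interaction G S Θ R} (hΦ : Φ.AbsSummable) (A : Finset G) :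
    Measurable (gibbsKernel Φ A) := by
  refine Measure.measurable_of_measurable_coe _ fun W hW => ?_
  simp_rw [gibbsKernel_apply Φ A _ hW]
  exact Finset.measurable_sum _ fun u _ => (measurable_gibbsWeight hΦ A u).ennreal_ofReal.mul
    ((measurable_one.indicator hW).comp (measurable_merge A u))

lemma bind_gibbsKernel {Φ : Interaction G S Θ R} (hΦ : Φ.AbsSummable) (A : Finset G)
    (μ : Measure (Θ × (G → S))) :
    μ.bind (gibbsKernel Φ A) = ∑ u : A → S,
      (μ.withDensity fun p => ENNReal.ofReal (gibbsWeight Φ A u p)).map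
        (fun p => (p.1, mergePat A p.2 u)) := by
  ext W hW
  have hw := fun u => (measurable_gibbsWeight hΦ A u).ennreal_ofReal
  rw [Measure.bind_apply hW (measurable_gibbsKernel hΦ A).aemeasurable, Measure.finsetSum_apply]
  simp_rw [gibbsKernel_apply Φ A _ hW]
  rw [lintegral_finsetSum _ fun u _ => by
    exact (hw u).mul ((measurable_one.indicator hW).comp (measurable_merge A u))]
  refine Finset.sum_congr rfl fun u _ => ?_
  have hW' := measurable_merge A u hW
  rw [Measure.map_apply (measurable_merge A u) hW, withDensity_apply _ hW',
    ← lintegral_indicator hW']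
  refine lintegral_congr fun p => ?_
  by_cases hp : (p.1, mergePat A p.2 u) ∈ W <;> simp [hp]

lemma integral_bind_gibbsKernel {Φ : Interaction G S Θ R} (hΦ : Φ.AbsSummable) (A : Finset G)
    (μ : Measure (Θ × (G → S))) [IsFiniteMeasure μ] {f : Θ × (G → S) → ℝ} (hf : Measurable f)
    {c : ℝ} (hc : ∀ p, |f p| ≤ c) :
    ∫ p, f p ∂(μ.bind (gibbsKernel Φ A)) =
      ∫ p, ∑ u : A → S, gibbsWeight Φ A u p * f (p.1, mergePat A p.2 u) ∂μ := by
  have hw := fun u => (measurable_gibbsWeight hΦ A u).ennreal_ofReal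
  have hfin : ∀ u, IsFiniteMeasure
      (μ.withDensity fun p => ENNReal.ofReal (gibbsWeight Φ A u p)) := fun u =>
    isFiniteMeasure_withDensity_ofReal (Integrable.of_bound
      (measurable_gibbsWeight hΦ A u).aestronglyMeasurable 1 (Eventually.of_forall fun p => by
        rw [Real.norm_of_nonneg (gibbsWeight_nonneg _ _ _ _)]
        exact gibbsWeight_le_one _ _ _ _)).2
  rw [bind_gibbsKernel hΦ, integral_finsetSum_measure fun u _ =>
    Integrable.of_bound hf.aestronglyMeasurable c (Eventually.of_forall hc), integral_finsetSum]
  · refine Finset.sum_congr rfl fun u _ => ?_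
    rw [integral_map (measurable_merge A u).aemeasurable hf.aestronglyMeasurable,
      integral_withDensity_eq_integral_toReal_smul (hw u) (by simp)]
    simp_rw [ENNReal.toReal_ofReal (gibbsWeight_nonneg Φ A u _), smul_eq_mul]
  · intro u _
    refine Integrable.of_bound ((measurable_gibbsWeight hΦ A u).mul
      (hf.comp (measurable_merge A u))).aestronglyMeasurable c (Eventually.of_forall fun p => ?_)
    rw [norm_mul, Real.norm_of_nonneg (gibbsWeight_nonneg _ _ _ _)]
    exact (mul_le_of_le_one_left (norm_nonneg _) (gibbsWeight_le_one _ _ _ _)).trans (hc _)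

lemma ae_mem_Omega {μ : Measure (Θ × (G → S))} [IsProbabilityMeasure μ]
    (hμ : μ R.Omega = 1) : ∀ᵐ p ∂μ, p ∈ R.Omega :=
  (prob_compl_eq_zero_iff R.omega_measurable).2 hμ

lemma isProbabilityMeasure_bind_gibbsKernel {Φ : Interaction G S Θ R} (hΦ : Φ.AbsSummable)
    (A : Finset G) {μ : Measure (Θ × (G → S))} [IsProbabilityMeasure μ]
    (hμ : μ R.Omega = 1) : IsProbabilityMeasure (μ.bind (gibbsKernel Φ A)) := by
  refine ⟨?_⟩
  rw [Measure.bind_apply MeasurableSet.univ (measurable_gibbsKernel hΦ A).aemeasurable]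
  have h : ∀ᵐ p ∂μ, gibbsKernel Φ A p Set.univ = 1 := by
    filter_upwards [ae_mem_Omega hμ] with p hp
    rw [gibbsKernel_apply _ _ _ MeasurableSet.univ]
    simp only [Set.indicator_univ, Pi.one_apply, mul_one]
    rw [← ENNReal.ofReal_sum_of_nonneg fun u _ => gibbsWeight_nonneg _ _ _ _,
      sum_gibbsWeight Φ A hp, ENNReal.ofReal_one]
  rw [lintegral_congr_ae h]
  simp

lemma condExp_cyl_bind_gibbsKernel {Φ : Interaction G S Θ R} (hΦ : Φ.AbsSummable)
    (A : Finset G) {μ : Measure (Θ × (G → S))} [IsProbabilityMeasure μ]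
    (hμ : μ R.Omega = 1) (u : A → S) :
    gibbsWeight Φ A u =ᵐ[μ.bind (gibbsKernel Φ A)]
      (μ.bind (gibbsKernel Φ A))[Set.indicator (cyl A u) (fun _ => (1 : ℝ)) |
        xi ((↑A : Set G)ᶜ) ⊔ FTheta] := by
  have := isProbabilityMeasure_bind_gibbsKernel hΦ A hμ
  have hw1 : ∀ p, |gibbsWeight Φ A u p| ≤ 1 := fun p => by
    rw [abs_of_nonneg (gibbsWeight_nonneg _ _ _ _)]
    exact gibbsWeight_le_one _ _ _ _
  have hwm := measurable_gibbsWeight hΦ A u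
  refine ae_eq_condExp_of_forall_setIntegral_eq (xi_sup_FTheta_le _)
    (integrable_indicator_cyl _ A u) (fun W _ _ => (Integrable.of_bound
      hwm.aestronglyMeasurable 1 (Eventually.of_forall hw1)).integrableOn) (fun W hW _ => ?_)
    (measurable_gibbsWeight_exterior hΦ A u).stronglyMeasurable.aestronglyMeasurable
  have hW' := xi_sup_FTheta_le _ _ hW
  have hcm : Measurable (Set.indicator (cyl A u : Set (Θ × (G → S))) (fun _ => (1 : ℝ))) :=
    measurable_const.indicator (measurableSet_cyl A u)
  rw [← integral_indicator hW', ← integral_indicator hW',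
    integral_bind_gibbsKernel hΦ A μ (hwm.indicator hW') (c := 1) fun p => ?_,
    integral_bind_gibbsKernel hΦ A μ (hcm.indicator hW') (c := 1) fun p => ?_]
  · refine integral_congr_ae ?_
    filter_upwards [ae_mem_Omega hμ] with p hp
    by_cases hpW : p ∈ W
    · simp only [Set.indicator, merge_mem_iff hW, hpW, if_true, gibbsWeight_merge,
        mul_ite, mul_one, mul_zero]
      rw [← Finset.sum_mul, sum_gibbsWeight Φ A hp, one_mul, Finset.sum_eq_single u,
        if_pos ((merge_mem_cyl_iff A p u u).2 rfl)]
      · exact fun v _ hv => if_neg fun h => hv ((merge_mem_cyl_iff A p u v).1 h)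
      · simp
    · simp [Set.indicator, merge_mem_iff hW, hpW]
  · by_cases hpW : p ∈ W <;> by_cases hpu : p ∈ cyl A u <;> simp [hpW, hpu]
  · by_cases hpW : p ∈ W
    · simpa [hpW] using hw1 p
    · simp [hpW]

lemma sum_negMulLog_gibbsWeight (Φ : Interaction G S Θ R) (A : Finset G) {p : Θ × (G → S)}
    (hp : p ∈ R.Omega) :
    ∑ u : A → S, Real.negMulLog (gibbsWeight Φ A u p) =
      ∑ u : A → S, gibbsWeight Φ A u p * condEnergy Φ A (p.1, mergePat A p.2 u) +
        Real.log (partitionZ Φ A p) := by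
  have hZ := partitionZ_pos Φ A hp
  have h : ∀ u : A → S, Real.negMulLog (gibbsWeight Φ A u p) =
      gibbsWeight Φ A u p * condEnergy Φ A (p.1, mergePat A p.2 u) +
        gibbsWeight Φ A u p * Real.log (partitionZ Φ A p) := by
    intro u
    unfold gibbsWeight boltzmann
    split_ifs
    · rw [Real.negMulLog, Real.log_div (Real.exp_pos _).ne' hZ.ne', Real.log_exp]
      ring
    · simp
  rw [Finset.sum_congr rfl fun u _ => h u, Finset.sum_add_distrib, ← Finset.sum_mul,
    sum_gibbsWeight Φ A hp, one_mul]

/-- The pressure on `A` after an application of the Gibbs kernel is the mean logarithm of the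
partition function. -/
lemma pressureCond_bind_gibbsKernel {Φ : Interaction G S Θ R} (hΦ : Φ.AbsSummable)
    (A : Finset G) {μ : Measure (Θ × (G → S))} [IsProbabilityMeasure μ]
    (hμ : μ R.Omega = 1) :
    pressureCond Φ (μ.bind (gibbsKernel Φ A)) A = ∫ p, Real.log (partitionZ Φ A p) ∂μ := by
  have hmem : ∀ u p, gibbsWeight Φ A u p ∈ Set.Icc (0 : ℝ) 1 := fun u p =>
    ⟨gibbsWeight_nonneg _ _ _ _, gibbsWeight_le_one _ _ _ _⟩
  have hnm : ∀ u, Measurable fun p => Real.negMulLog (gibbsWeight Φ A u p) := fun u =>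
    Real.continuous_negMulLog.measurable.comp (measurable_gibbsWeight hΦ A u)
  have hEm := measurable_condEnergy hΦ A
  have hEc := abs_condEnergy_le hΦ A
  have hent : condEntropy (μ.bind (gibbsKernel Φ A)) A (xi ((↑A : Set G)ᶜ) ⊔ FTheta) =
      ∫ p, ∑ u : A → S, Real.negMulLog (gibbsWeight Φ A u p) ∂μ := by
    have h1 : condEntropy (μ.bind (gibbsKernel Φ A)) A (xi ((↑A : Set G)ᶜ) ⊔ FTheta) =
        ∫ p, ∑ u : A → S, Real.negMulLog (gibbsWeight Φ A u p) ∂(μ.bind (gibbsKernel Φ A)) := by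
      refine integral_congr_ae ?_
      filter_upwards [ae_all_iff.2 fun u => condExp_cyl_bind_gibbsKernel hΦ A hμ u] with p hp
      exact Finset.sum_congr rfl fun u _ => by rw [hp u]
    rw [h1, integral_bind_gibbsKernel hΦ A μ (Finset.measurable_sum _ fun u _ => hnm u)
      (c := ∑ u : A → S, 1) fun p => ?_]
    · refine integral_congr_ae ?_
      filter_upwards [ae_mem_Omega hμ] with p hp
      simp only [gibbsWeight_merge]
      rw [← Finset.sum_mul, sum_gibbsWeight Φ A hp, one_mul]
    · exact (Finset.abs_sum_le_sum_abs _ _).trans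
        (Finset.sum_le_sum fun u _ => norm_negMulLog_le_one (hmem u p))
  rw [pressureCond, hent, integral_bind_gibbsKernel hΦ A μ hEm hEc, ← integral_sub]
  · refine integral_congr_ae ?_
    filter_upwards [ae_mem_Omega hμ] with p hp
    rw [sum_negMulLog_gibbsWeight Φ A hp, add_sub_cancel_left]
  · exact integrable_finsetSum _ fun u _ => Integrable.of_bound (hnm u).aestronglyMeasurable 1
      (Eventually.of_forall fun p => norm_negMulLog_le_one (hmem u p))
  · refine integrable_finsetSum _ fun u _ => Integrable.of_bound
      ((measurable_gibbsWeight hΦ A u).mul (hEm.comp (measurable_merge A u))).aestronglyMeasurable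
      (∑' C, energyBound Φ A C) (Eventually.of_forall fun p => ?_)
    rw [norm_mul, Real.norm_of_nonneg (gibbsWeight_nonneg _ _ _ _)]
    exact (mul_le_of_le_one_left (norm_nonneg _) (gibbsWeight_le_one _ _ _ _)).trans (hEc _)

/-- Two measures on the system that agree on the environment and the coordinates in `B` give
nearly the same mean to an observable that nearly depends on these data only. -/
lemma integral_le_add_of_agree {B : Finset G} {μ μ' : Measure (Θ × (G → S))}
    [IsProbabilityMeasure μ] [IsProbabilityMeasure μ'] (hμ : μ R.Omega = 1)
    (hμ' : μ' R.Omega = 1)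
    (hagree : ∀ W : Set (Θ × (G → S)), MeasurableSet[FTheta ⊔ xi (↑B : Set G)] W → μ' W = μ W)
    {f : Θ × (G → S) → ℝ} (hf : Measurable f) {c δ : ℝ} (hc : ∀ p, |f p| ≤ c)
    (hδ : ∀ θ : Θ, ∀ x ∈ R.X θ, ∀ y ∈ R.X θ, (∀ b ∈ B, x b = y b) →
      f (θ, x) ≤ f (θ, y) + δ) :
    ∫ p, f p ∂μ ≤ ∫ p, f p ∂μ' + δ := by
  let q : Θ × (G → S) → Θ × ((↑B : Set G) → S) := fun p => (p.1, fun b => p.2 b)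
  have hq : Measurable q := measurable_fst.prodMk
    (measurable_pi_lambda _ fun b => (measurable_pi_apply b.1).comp measurable_snd)
  have hr : Measurable fun p : Θ × (G → S) => (q p, p.2) := hq.prodMk measurable_snd
  let F : (Θ × ((↑B : Set G) → S)) × (G → S) → ℝ := fun t => f (t.1.1, t.2)
  have hF : Measurable F :=
    hf.comp ((measurable_fst.comp measurable_fst).prodMk measurable_snd)
  have hFint : ∀ τ : Measure ((Θ × ((↑B : Set G) → S)) × (G → S)), IsFiniteMeasure τ →
      Integrable F τ := fun τ _ =>
    Integrable.of_bound hF.aestronglyMeasurable c (Eventually.of_forall fun t => hc _)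
  have key : ∀ ν : Measure (Θ × (G → S)), IsProbabilityMeasure ν → ν R.Omega = 1 →
      ∃ κ : ProbabilityTheory.Kernel (Θ × ((↑B : Set G) → S)) (G → S),
        ProbabilityTheory.IsMarkovKernel κ ∧
        ∫ p, f p ∂ν = ∫ z, ∫ x, F (z, x) ∂(κ z) ∂(ν.map q) ∧
        Integrable (fun z => ∫ x, F (z, x) ∂(κ z)) (ν.map q) ∧
        ∀ᵐ z ∂(ν.map q), ∀ᵐ x ∂(κ z), x ∈ R.X z.1 ∧ ∀ b, x b.1 = z.2 b := by
    intro ν _ hν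
    have : IsProbabilityMeasure (ν.map q) := Measure.isProbabilityMeasure_map hq.aemeasurable
    have : IsProbabilityMeasure (ν.map fun p => (q p, p.2)) :=
      Measure.isProbabilityMeasure_map hr.aemeasurable
    have hdis : Measure.compProd (ν.map q) (ν.map fun p => (q p, p.2)).condKernel =
        ν.map fun p => (q p, p.2) := by
      rw [← Measure.fst_map_prodMk (X := q) measurable_snd]
      exact Measure.disintegrate _ _
    refine ⟨(ν.map fun p => (q p, p.2)).condKernel, inferInstance, ?_, ?_, ?_⟩
    · rw [← Measure.integral_compProd (f := F), hdis,
        integral_map hr.aemeasurable hF.aestronglyMeasurable]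
      exact hFint _ inferInstance
    · refine Integrable.of_bound
        hF.stronglyMeasurable.integral_kernel_prod_right'.aestronglyMeasurable c
        (Eventually.of_forall fun z => ?_)
      simpa using norm_integral_le_of_norm_le_const (C := c) (f := fun x => F (z, x))
        (μ := (ν.map fun p => (q p, p.2)).condKernel z) (Eventually.of_forall fun x => hc _)
    · refine Measure.ae_ae_of_ae_compProd
        (p := fun t : (Θ × ((↑B : Set G) → S)) × (G → S) => t.2 ∈ R.X t.1.1 ∧
          ∀ b, t.2 b.1 = t.1.2 b) ?_
      rw [hdis]
      refine (ae_map_iff hr.aemeasurable ?_).2 ?_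
      · refine MeasurableSet.inter (R.omega_measurable.preimage
          ((measurable_fst.comp measurable_fst).prodMk measurable_snd)) ?_
        have hset : {t : (Θ × ((↑B : Set G) → S)) × (G → S) | ∀ b, t.2 b.1 = t.1.2 b} =
            ⋂ b, {t | t.2 b.1 = t.1.2 b} := by
          ext t
          simp
        change MeasurableSet {t : (Θ × ((↑B : Set G) → S)) × (G → S) | ∀ b, t.2 b.1 = t.1.2 b}
        exact hset ▸ MeasurableSet.iInter fun b => measurableSet_eq_fun
          ((measurable_pi_apply b.1).comp measurable_snd)
          ((measurable_pi_apply b).comp (measurable_snd.comp measurable_fst))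
      · filter_upwards [ae_mem_Omega hν] with p hp
        exact ⟨hp, fun b => rfl⟩
  have hmap : μ'.map q = μ.map q := by
    ext V hV
    rw [Measure.map_apply hq hV, Measure.map_apply hq hV]
    refine hagree _ ?_
    rw [FTheta_sup_xi_eq_comap]
    exact ⟨V, hV, rfl⟩
  obtain ⟨κ, hκ, h1, h2, h3⟩ := key μ inferInstance hμ
  obtain ⟨κ', hκ', h1', h2', h3'⟩ := key μ' inferInstance hμ'
  rw [hmap] at h1' h2' h3'
  have : IsProbabilityMeasure (μ.map q) := Measure.isProbabilityMeasure_map hq.aemeasurable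
  have hfib : ∀ z, ∀ η : Measure (G → S), IsFiniteMeasure η →
      Integrable (fun x => F (z, x)) η := fun z η _ =>
    Integrable.of_bound (hF.comp (measurable_const.prodMk measurable_id)).aestronglyMeasurable c
      (Eventually.of_forall fun t => hc _)
  have hconst : ∫ p, f p ∂μ' + δ = ∫ z, (∫ x, F (z, x) ∂(κ' z) + δ) ∂(μ.map q) := by
    rw [integral_add h2' (integrable_const _), h1']
    simp
  rw [hconst, h1]
  refine integral_mono_ae h2 (h2'.add (integrable_const _)) ?_
  filter_upwards [h3, h3'] with z hz hz'
  have hx : ∀ᵐ x ∂(κ z), F (z, x) ≤ ∫ y, F (z, y) ∂(κ' z) + δ := by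
    filter_upwards [hz] with x hx
    have hy : ∀ᵐ y ∂(κ' z), F (z, x) - δ ≤ F (z, y) := by
      filter_upwards [hz'] with y hy
      have := hδ z.1 x hx.1 y hy.1 fun b hb => (hx.2 ⟨b, hb⟩).trans (hy.2 ⟨b, hb⟩).symm
      exact sub_le_iff_le_add.2 this
    have := integral_mono_ae (integrable_const _) (hfib z (κ' z) inferInstance) hy
    rw [integral_const, probReal_univ, one_smul] at this
    linarith
  have := integral_mono_ae (hfib z (κ z) inferInstance) (integrable_const _) hx
  rwa [integral_const, probReal_univ, one_smul] at this

lemma abs_log_partitionZ_le {Φ : Interaction G S Θ R} (hΦ : Φ.AbsSummable) (A : Finset G)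
    (p : Θ × (G → S)) :
    |Real.log (partitionZ Φ A p)| ≤
      Real.log (Fintype.card (A → S)) + ∑' C, energyBound Φ A C := by
  set c := ∑' C, energyBound Φ A C
  have hcard : (1 : ℝ) ≤ Fintype.card (A → S) := by exact_mod_cast Fintype.card_pos
  have hlog := Real.log_nonneg hcard
  have hE := abs_condEnergy_le hΦ A
  have hc : 0 ≤ c := (abs_nonneg _).trans (hE p)
  rcases (partitionZ_nonneg Φ A p).eq_or_lt with hZ | hZ
  · rw [← hZ, Real.log_zero, abs_zero]
    positivity
  have hupper : partitionZ Φ A p ≤ Fintype.card (A → S) * Real.exp c := by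
    rw [partitionZ_eq_sum, ← nsmul_eq_mul]
    refine Finset.sum_le_card_nsmul _ _ _ fun u _ => ?_
    unfold boltzmann
    split_ifs
    · exact Real.exp_le_exp.2 ((neg_le_abs _).trans (hE _))
    · exact (Real.exp_pos _).le
  have hlower : Real.exp (-c) ≤ partitionZ Φ A p := by
    obtain ⟨u, -, hu⟩ := Finset.exists_ne_zero_of_sum_ne_zero hZ.ne'
    refine le_trans ?_ (Finset.single_le_sum
      (f := fun v : A → S => boltzmann Φ A (p.1, mergePat A p.2 v))
      (fun _ _ => boltzmann_nonneg _ _ _) (Finset.mem_univ u))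
    have hmem : mergePat A p.2 u ∈ R.X p.1 := by
      by_contra h
      exact hu (if_neg h)
    simp only [boltzmann, if_pos hmem]
    exact Real.exp_le_exp.2 (neg_le_neg ((le_abs_self _).trans (hE _)))
  have h1 := Real.log_le_log hZ hupper
  have h2 := Real.log_le_log (Real.exp_pos _) hlower
  rw [Real.log_mul (by positivity) (Real.exp_pos _).ne', Real.log_exp] at h1
  rw [Real.log_exp] at h2
  exact abs_le.2 ⟨by linarith, h1⟩

/-- Under the weak topological Markov property, the logarithm of the partition function is
relatively continuous. -/
lemma exists_log_partitionZ_le (hTMP : R.WeakTMP) {Φ : Interaction G S Θ R}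
    (hΦ : Φ.AbsSummable) (A : Finset G) {δ : ℝ} (hδ : 0 < δ) :
    ∃ B₃ : Finset G, ∀ B : Finset G, B₃ ⊆ B → ∀ θ : Θ, ∀ x ∈ R.X θ, ∀ y ∈ R.X θ,
      (∀ b ∈ B, x b = y b) →
      Real.log (partitionZ Φ A (θ, x)) ≤ Real.log (partitionZ Φ A (θ, y)) + 2 * δ := by
  obtain ⟨B₁, hAB₁, hB₁⟩ := exists_condEnergy_approx hΦ A hδ
  obtain ⟨M, hAM, hM⟩ := hTMP A
  refine ⟨B₁ ∪ M, fun B hB θ x hx y hy hxy => ?_⟩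
  have hterm : ∀ u : A → S, boltzmann Φ A (θ, mergePat A x u) ≤
      Real.exp (2 * δ) * boltzmann Φ A (θ, mergePat A y u) := by
    intro u
    by_cases hxu : mergePat A x u ∈ R.X θ
    · have hyu : mergePat A y u ∈ R.X θ := by
        have h := hM θ _ hxu y hy fun g hg => by
          rw [Finset.mem_sdiff] at hg
          simp only [mergePat, hg.2, dite_false]
          exact hxy g (hB (Finset.mem_union_right _ hg.1))
        convert! h using 1
        funext g
        by_cases hgA : g ∈ A
        · simp [mergePat, hgA, hAM hgA]
        · by_cases hgM : g ∈ M
          · simp [mergePat, hgA, hgM, hxy g (hB (Finset.mem_union_right _ hgM))]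
          · simp [mergePat, hgA, hgM]
      have hE := condEnergyFin_congr Φ A (θ := θ) (x := mergePat A x u) (y := mergePat A y u)
        hAB₁ fun g hg => by
          by_cases hgA : g ∈ A
          · simp [mergePat, hgA]
          · simp [mergePat, hgA, hxy g (hB (Finset.mem_union_left _ hg))]
      have h1 := abs_le.1 (hB₁ B₁ le_rfl (θ, mergePat A x u))
      have h2 := abs_le.1 (hB₁ B₁ le_rfl (θ, mergePat A y u))
      rw [boltzmann, boltzmann, if_pos hxu, if_pos hyu, ← Real.exp_add]
      exact Real.exp_le_exp.2 (by linarith [h1.1, h2.2])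
    · rw [boltzmann, if_neg hxu]
      exact mul_nonneg (Real.exp_pos _).le (boltzmann_nonneg _ _ _)
  have hZx : 0 < partitionZ Φ A (θ, x) := partitionZ_pos Φ A hx
  have hZy : 0 < partitionZ Φ A (θ, y) := partitionZ_pos Φ A hy
  have hZ : partitionZ Φ A (θ, x) ≤ Real.exp (2 * δ) * partitionZ Φ A (θ, y) := by
    rw [partitionZ_eq_sum, partitionZ_eq_sum, Finset.mul_sum]
    exact Finset.sum_le_sum fun u _ => hterm u
  have h := Real.log_le_log hZx hZ
  rw [Real.log_mul (Real.exp_pos _).ne' hZy.ne', Real.log_exp] at h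
  linarith

lemma abs_integral_condEnergy_sub_le {Φ : Interaction G S Θ R} (hΦ : Φ.AbsSummable)
    {A B : Finset G} {δ : ℝ} (h : ∀ p : Θ × (G → S),
      |condEnergy Φ A p - condEnergyFin Φ A (B \ A) p| ≤ δ)
    (ν : Measure (Θ × (G → S))) [IsProbabilityMeasure ν] :
    |∫ p, condEnergy Φ A p ∂ν - ∫ p, condEnergyFin Φ A (B \ A) p ∂ν| ≤ δ := by
  have h1 : Integrable (condEnergy Φ A) ν := Integrable.of_bound
    (measurable_condEnergy hΦ A).aestronglyMeasurable _
    (Eventually.of_forall (abs_condEnergy_le hΦ A))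
  have h2 : Integrable (fun p => condEnergy Φ A p - condEnergyFin Φ A (B \ A) p) ν :=
    Integrable.of_bound ((measurable_condEnergy hΦ A).sub
      (measurable_condEnergyFin Φ A (B \ A))).aestronglyMeasurable δ (Eventually.of_forall h)
  have h3 : Integrable (condEnergyFin Φ A (B \ A)) ν := by
    refine (h1.sub h2).congr (Eventually.of_forall fun p => ?_)
    simp
  rw [← integral_sub h1 h3]
  have := norm_integral_le_of_norm_le_const (μ := ν) (C := δ)
    (f := fun p => condEnergy Φ A p - condEnergyFin Φ A (B \ A) p) (Eventually.of_forall h)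
  simpa using this

/-- **Local enhancement lemma** (Lemma 3.2): if applying the Gibbs kernel `K_A`
strictly increases the conditional relative pressure on `A`, then there are `ε > 0`
and a finite `B₀ ⊇ A` such that for every finite `B ⊇ B₀` and every probability
measure `μ'` agreeing with `μ` on `F_Θ ∨ ξ^{B₀}`,
`Ψ_μ(A | B∖A) ≤ Ψ_{μ'K_A}(A | B∖A) − ε`. -/
theorem local_enhancement
    {G : Type} [Group G] [Countable G] [DecidableEq G]
    {S : Type} [Fintype S] [Nonempty S] [TopologicalSpace S] [DiscreteTopology S]
    [MeasurableSpace S] [MeasurableSingletonClass S]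
    {Θ : Type} [MeasurableSpace Θ]
    {R : RelSystem G S Θ} (hTMP : R.WeakTMP)
    (Φ : Interaction G S Θ R) (hΦ : Φ.AbsSummable)
    (μ : Measure (Θ × (G → S))) [IsProbabilityMeasure μ] (hμΩ : μ R.Omega = 1)
    (A : Finset G)
    (hlt : pressureCond Φ μ A < pressureCond Φ (μ.bind (gibbsKernel Φ A)) A) :
    ∃ ε > (0:ℝ), ∃ B₀ : Finset G, A ⊆ B₀ ∧
      ∀ B : Finset G, B₀ ⊆ B →
      ∀ μ' : Measure (Θ × (G → S)), IsProbabilityMeasure μ' → μ' R.Omega = 1 →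
        (∀ W : Set (Θ × (G → S)), MeasurableSet[FTheta ⊔ xi (↑B₀ : Set G)] W →
          μ' W = μ W) →
        pressureCondFin Φ μ A (B \ A) ≤
          pressureCondFin Φ (μ'.bind (gibbsKernel Φ A)) A (B \ A) - ε := by
  set c := pressureCond Φ (μ.bind (gibbsKernel Φ A)) A - pressureCond Φ μ A with hcdef
  have hc : 0 < c := sub_pos.2 hlt
  have hδ : 0 < c / 6 := by positivity
  obtain ⟨B₁, hAB₁, hB₁⟩ := exists_condEnergy_approx hΦ A hδ
  obtain ⟨B₂, hB₂⟩ := exists_condEntropy_le μ A hδ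
  obtain ⟨B₃, hB₃⟩ := exists_log_partitionZ_le hTMP hΦ A hδ
  refine ⟨c / 6, hδ, B₁ ∪ B₂ ∪ B₃, hAB₁.trans
    (Finset.subset_union_left.trans Finset.subset_union_left), fun B hB μ' _ hμ'Ω hagree => ?_⟩
  have hB₁B : B₁ ⊆ B := (Finset.subset_union_left.trans Finset.subset_union_left).trans hB
  have hB₂B : B₂ ⊆ B := (Finset.subset_union_right.trans Finset.subset_union_left).trans hB
  have := isProbabilityMeasure_bind_gibbsKernel hΦ A hμ'Ω
  have hE := abs_le.1 (abs_integral_condEnergy_sub_le hΦ (hB₁ B hB₁B) μ)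
  have hE' := abs_le.1 (abs_integral_condEnergy_sub_le hΦ (hB₁ B hB₁B)
    (μ'.bind (gibbsKernel Φ A)))
  have hH := hB₂ B hB₂B
  have hH' := condEntropy_anti (μ'.bind (gibbsKernel Φ A)) A
    (sup_le_sup_right (xi_mono (B := (↑(B \ A) : Set G)) (B' := (↑A : Set G)ᶜ)
      fun g hg => (Finset.mem_sdiff.1 (Finset.mem_coe.1 hg)).2) FTheta) (xi_sup_FTheta_le _)
  have hZ := integral_le_add_of_agree hμΩ hμ'Ω hagree
    (measurable_partitionZ hΦ A).log (abs_log_partitionZ_le hΦ A)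
    (hB₃ _ Finset.subset_union_right)
  have hP := pressureCond_bind_gibbsKernel hΦ A hμΩ
  have hP' := pressureCond_bind_gibbsKernel hΦ A hμ'Ω
  have hμ : pressureCond Φ μ A = condEntropy μ A (xi ((↑A : Set G)ᶜ) ⊔ FTheta) -
    ∫ p, condEnergy Φ A p ∂μ := rfl
  rw [← hP, ← hP'] at hZ
  rw [pressureCond.eq_def Φ (μ'.bind (gibbsKernel Φ A))] at hZ
  simp only [pressureCondFin]
  linarith [hE.1, hE.2, hE'.1, hE'.2]

end DLR
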